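/- Let n, m ≥ 1, A ∈ ℝ^{n×n}, F ∈ ℝ^{n×m} with F ≠ 0, and let Q ∈ ℝ^{n×n}, R ∈ ℝ^{m×m} be symmetric positive definite. Suppose P* ∈ ℝ^{n×n} is symmetric positive definite and solves the Riccati equation AᵀP* + P*A − P*FR⁻¹FᵀP* + Q = 0; set K* = R⁻¹FᵀP*; and suppose Y* ∈ ℝ^{n×n} is symmetric positive definite and solves (A − FK*)Y* + Y*(A − FK*)ᵀ + I_n = 0. Let K ∈ ℝ^{m×n} be any gain for which there exist symmetric positive definite matrices P_K, Y_K ∈ ℝ^{n×n} with (A − FK)ᵀP_K + P_K(A − FK) + Q + KᵀRK = 0 and (A − FK)Y_K + Y_K(A − FK)ᵀ + I_n = 0. Define b₁ = ‖F‖ √(2(λ_min(Y*) + λ_max(Y*))) / ( λ_min(R) √(λ_min(Y*)) ) and b₂ = ‖A − FK*‖_F² √(λ_min(Y*)) √(λ_min(Y*) + λ_max(Y*)) / ( √2 ‖F‖ ). Then tr(P_K) ≥ tr(P*) and, setting h = tr(P_K) − tr(P*), the Frobenius norm of the policy gradient satisfies ‖2(RK − FᵀP_K)Y_K‖_F ≥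 h / (b₁ h + b₂). -/

import Mathlib

open Matrix

/-- Spectral norm (ℓ²-operator norm) of a real matrix. -/
noncomputable def specNorm {p q : ℕ} (M : Matrix (Fin p) (Fin q) ℝ) : ℝ :=
  ‖LinearMap.toContinuousLinearMap (Matrix.toEuclideanLin M)‖

/-- Frobenius norm of a real matrix. -/
noncomputable def frobNorm {p q : ℕ} (M : Matrix (Fin p) (Fin q) ℝ) : ℝ :=
  Real.sqrt (∑ i, ∑ j, (M i j) ^ 2)

/-- Smallest eigenvalue of a real symmetric (Hermitian) matrix. -/
noncomputable def eigMin {p : ℕ} (M : Matrix (Fin p) (Fin p) ℝ) (hM : M.IsHermitian) : ℝ :=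
  ⨅ i, hM.eigenvalues i

/-- Largest eigenvalue of a real symmetric (Hermitian) matrix. -/
noncomputable def eigMax {p : ℕ} (M : Matrix (Fin p) (Fin p) ℝ) (hM : M.IsHermitian) : ℝ :=
  ⨆ i, hM.eigenvalues i

lemma le_of_sq_le_sq_aux {a b : ℝ} (h : a ^ 2 ≤ b ^ 2) (hb : 0 ≤ b) : a ≤ b := (abs_le_of_sq_le_sq' h hb).2

section aux
variable {p q r : ℕ}

lemma frob_sq (X : Matrix (Fin p) (Fin q) ℝ) : frobNorm X ^ 2 = (Xᵀ * X).trace := by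
  unfold frobNorm
  rw [Real.sq_sqrt (by positivity)]
  simp only [Matrix.trace, Matrix.diag, Matrix.mul_apply, Matrix.transpose_apply]
  rw [Finset.sum_comm]
  simp [sq]

lemma frob_nonneg (X : Matrix (Fin p) (Fin q) ℝ) : 0 ≤ frobNorm X := Real.sqrt_nonneg _

lemma frob_cs (X Y : Matrix (Fin p) (Fin q) ℝ) :
    (Xᵀ * Y).trace ≤ frobNorm X * frobNorm Y := by
  have h := Real.sum_mul_le_sqrt_mul_sqrt Finset.univ (fun i : Fin p × Fin q => X i.1 i.2)
    (fun i => Y i.1 i.2)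
  simp only [Fintype.sum_prod_type] at h
  unfold frobNorm
  refine le_trans (le_of_eq ?_) h
  simp only [Matrix.trace, Matrix.diag, Matrix.mul_apply, Matrix.transpose_apply]
  rw [Finset.sum_comm]

lemma frob_transpose (X : Matrix (Fin p) (Fin q) ℝ) : frobNorm Xᵀ = frobNorm X := by
  unfold frobNorm
  rw [Finset.sum_comm]; rfl

lemma frob_eq (X : Matrix (Fin p) (Fin q) ℝ) :
    frobNorm X = @norm _ Matrix.frobeniusNormedAddCommGroup.toNorm X := by
  rw [Matrix.frobenius_norm_def, frobNorm, Real.sqrt_eq_rpow]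
  simp

lemma frob_mul (X : Matrix (Fin p) (Fin q) ℝ) (Y : Matrix (Fin q) (Fin r) ℝ) :
    frobNorm (X * Y) ≤ frobNorm X * frobNorm Y := by
  simp only [frob_eq]
  exact Matrix.frobenius_norm_mul X Y

lemma spec_mul (X : Matrix (Fin p) (Fin q) ℝ) (Y : Matrix (Fin q) (Fin r) ℝ) :
    frobNorm (X * Y) ≤ specNorm X * frobNorm Y := by
  have hs : 0 ≤ specNorm X := norm_nonneg _
  unfold frobNorm
  apply Real.sqrt_le_iff.2
  refine ⟨by positivity, ?_⟩
  rw [mul_pow, Real.sq_sqrt (by positivity), Finset.sum_comm, Finset.sum_comm (s := (Finset.univ : Finset (Fin q))), Finset.mul_sum]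
  refine Finset.sum_le_sum fun j _ => ?_
  have h := (LinearMap.toContinuousLinearMap (Matrix.toEuclideanLin X)).le_opNorm
    (WithLp.toLp 2 (fun i => Y i j))
  have h2 := pow_le_pow_left₀ (norm_nonneg _) h 2
  rw [mul_pow, EuclideanSpace.norm_sq_eq, EuclideanSpace.norm_sq_eq] at h2
  simpa [Matrix.mul_apply, Matrix.mulVec, dotProduct, specNorm] using h2

lemma spec_pos (X : Matrix (Fin p) (Fin q) ℝ) (h : X ≠ 0) : 0 < specNorm X := by
  unfold specNorm
  rw [norm_pos_iff]
  intro h0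
  apply h
  have : Matrix.toEuclideanLin X = 0 := by
    apply LinearMap.toContinuousLinearMap.injective
    simpa using h0
  simpa using this

lemma sub_psd (M : Matrix (Fin p) (Fin p) ℝ) (hM : M.IsHermitian) (c : ℝ)
    (hc : ∀ i, c ≤ hM.eigenvalues i) : (M - c • (1 : Matrix (Fin p) (Fin p) ℝ)).PosSemidef := by
  have hs := hM.spectral_theorem
  set U := (hM.eigenvectorUnitary : Matrix (Fin p) (Fin p) ℝ) with hU
  have hUU : U * star U = 1 := by
    rw [hU]; exact Unitary.mul_star_self_of_mem hM.eigenvectorUnitary.2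
  have h1 : M - c • (1 : Matrix (Fin p) (Fin p) ℝ)
      = U * diagonal (fun i => hM.eigenvalues i - c) * star U := by
    have : diagonal (fun i => hM.eigenvalues i - c)
        = diagonal hM.eigenvalues - c • (1 : Matrix (Fin p) (Fin p) ℝ) := by
      ext i j; by_cases hij : i = j <;> simp [hij, diagonal, Matrix.one_apply]
    rw [this, Matrix.mul_sub, Matrix.sub_mul]
    simp only [Matrix.mul_smul, Matrix.smul_mul, Matrix.mul_one, hUU]
    congr 1
  rw [h1]
  apply Matrix.PosSemidef.mul_mul_conjTranspose_same
  apply Matrix.PosSemidef.diagonal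
  intro i
  simpa using hc i

lemma psd_sub (M : Matrix (Fin p) (Fin p) ℝ) (hM : M.IsHermitian) (c : ℝ)
    (hc : ∀ i, hM.eigenvalues i ≤ c) : (c • (1 : Matrix (Fin p) (Fin p) ℝ) - M).PosSemidef := by
  have hs := hM.spectral_theorem
  set U := (hM.eigenvectorUnitary : Matrix (Fin p) (Fin p) ℝ) with hU
  have hUU : U * star U = 1 := by
    rw [hU]; exact Unitary.mul_star_self_of_mem hM.eigenvectorUnitary.2
  have h1 : c • (1 : Matrix (Fin p) (Fin p) ℝ) - M
      = U * diagonal (fun i => c - hM.eigenvalues i) * star U := by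
    have : diagonal (fun i => c - hM.eigenvalues i)
        = c • (1 : Matrix (Fin p) (Fin p) ℝ) - diagonal hM.eigenvalues := by
      ext i j; by_cases hij : i = j <;> simp [hij, diagonal, Matrix.one_apply]
    rw [this, Matrix.mul_sub, Matrix.sub_mul]
    simp only [Matrix.mul_smul, Matrix.smul_mul, Matrix.mul_one, hUU]
    congr 1
  rw [h1]
  apply Matrix.PosSemidef.mul_mul_conjTranspose_same
  apply Matrix.PosSemidef.diagonal
  intro i
  simpa using hc i

lemma eigMin_le (M : Matrix (Fin p) (Fin p) ℝ) (hM : M.IsHermitian) (i) :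
    eigMin M hM ≤ hM.eigenvalues i := ciInf_le (Set.finite_range _).bddBelow i

lemma le_eigMax (M : Matrix (Fin p) (Fin p) ℝ) (hM : M.IsHermitian) (i) :
    hM.eigenvalues i ≤ eigMax M hM := le_ciSup (Set.finite_range _).bddAbove i

lemma eigMin_pos (M : Matrix (Fin p) (Fin p) ℝ) (hM : M.PosDef) (hp : 1 ≤ p) :
    0 < eigMin M hM.isHermitian := by
  have : Nonempty (Fin p) := ⟨⟨0, hp⟩⟩
  obtain ⟨i, hi⟩ := exists_eq_ciInf_of_finite (f := hM.isHermitian.eigenvalues)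
  unfold eigMin
  rw [← hi]
  exact hM.eigenvalues_pos i

lemma tr_ge (M : Matrix (Fin p) (Fin p) ℝ) (hM : M.IsHermitian) (X : Matrix (Fin p) (Fin q) ℝ) :
    eigMin M hM * frobNorm X ^ 2 ≤ (Xᵀ * M * X).trace := by
  have h := ((sub_psd M hM _ (eigMin_le M hM)).conjTranspose_mul_mul_same X).trace_nonneg
  rw [conjTranspose_eq_transpose_of_trivial, Matrix.mul_sub, Matrix.sub_mul, trace_sub] at h
  simp only [Matrix.mul_smul, Matrix.smul_mul, Matrix.mul_one, trace_smul, smul_eq_mul] at h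
  rw [frob_sq]; linarith

lemma tr_le (M : Matrix (Fin p) (Fin p) ℝ) (hM : M.IsHermitian) (X : Matrix (Fin p) (Fin q) ℝ) :
    (Xᵀ * M * X).trace ≤ eigMax M hM * frobNorm X ^ 2 := by
  have h := ((psd_sub M hM _ (le_eigMax M hM)).conjTranspose_mul_mul_same X).trace_nonneg
  rw [conjTranspose_eq_transpose_of_trivial, Matrix.mul_sub, Matrix.sub_mul, trace_sub] at h
  simp only [Matrix.mul_smul, Matrix.smul_mul, Matrix.mul_one, trace_smul, smul_eq_mul] at h
  rw [frob_sq]; linarith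

/-- final scalar inequality -/
lemma scalar_core (h d z f l y Y G g H b₁ b₂ : ℝ) (hh : 0 ≤ h) (hd : 0 ≤ d) 
    (hf : 0 < f) (hl : 0 < l) (hy : 0 < y) (hyY : y ≤ Y) (hG : 0 ≤ G) (hg : 0 ≤ g)
    (hz : z ≤ 2 * Real.sqrt Y * G + 2 * f * d)
    (hH : h + l * d ^ 2 ≤ H) (hHg : H ≤ g * (z * d))
    (hb₁ : b₁ = f * Real.sqrt (2 * (y + Y)) / (l * Real.sqrt y))
    (hb₂ : b₂ = G ^ 2 * Real.sqrt y * Real.sqrt (y + Y) / (Real.sqrt 2 * f)) :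
    h / (b₁ * h + b₂) ≤ g := by
  have hY : 0 < Y := by linarith
  have hb1 : 0 ≤ b₁ := by rw [hb₁]; positivity
  have hb2 : 0 ≤ b₂ := by rw [hb₂]; positivity
  apply div_le_of_le_mul₀ (by positivity) hg
  rcases hh.eq_or_lt with h0 | h0
  · rw [← h0]; simp; positivity
  set s := Real.sqrt y with hs
  set S := Real.sqrt Y with hS
  set w := Real.sqrt (y + Y) with hw
  set t := Real.sqrt 2 with ht
  have e1 : s ^ 2 = y := Real.sq_sqrt hy.le
  have e2 : S ^ 2 = Y := Real.sq_sqrt hY.le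
  have e3 : w ^ 2 = y + Y := Real.sq_sqrt (by linarith)
  have e4 : t ^ 2 = 2 := Real.sq_sqrt (by norm_num)
  have e5 : Real.sqrt (2 * (y + Y)) = t * w := Real.sqrt_mul (by norm_num) _
  have sp : 0 < s := Real.sqrt_pos.2 hy
  have Sp : 0 < S := Real.sqrt_pos.2 hY
  have wp : 0 < w := Real.sqrt_pos.2 (by linarith)
  have tp : 0 < t := Real.sqrt_pos.2 (by norm_num)
  rw [e5] at hb₁
  -- b₁ l ≥ 2 f
  have k1 : 2 * f ≤ b₁ * l := by
    have : b₁ * l = f * (t * w) / s := by rw [hb₁]; field_simp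
    rw [this, le_div_iff₀ sp]
    have : 2 * s ≤ t * w := by
      apply le_of_sq_le_sq_aux <;> first | positivity | nlinarith
    nlinarith
  have k2 : b₁ * b₂ * l = G ^ 2 * w ^ 2 := by
    rw [hb₁, hb₂]; field_simp
  have k3 : S ≤ w := Real.sqrt_le_sqrt (by linarith)
  have k4 : 2 * S * G * d * h ≤ b₁ * h ^ 2 + b₂ * (l * d ^ 2) := by
    have a1 : 2 * S * G * d * h ≤ 2 * (w * G * d * h) := by
      have := mul_le_mul_of_nonneg_right k3 (show 0 ≤ G * d * h by positivity)
      linarith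
    refine a1.trans ?_
    have a2 : (w * G * d * h) ^ 2 = (b₁ * h ^ 2) * (b₂ * (l * d ^ 2)) := by
      linear_combination (-(d^2 * h^2)) * k2
    have a3 : 0 ≤ b₁ * h ^ 2 := by positivity
    have a4 : 0 ≤ b₂ * (l * d ^ 2) := by positivity
    have a5 : 0 ≤ w * G * d * h := by positivity
    apply le_of_sq_le_sq_aux _ (by positivity)
    rw [mul_pow, a2]
    clear_value s S w t
    generalize b₁ * h ^ 2 = X at *
    generalize b₂ * (l * d ^ 2) = W at *
    nlinarith [sq_nonneg (X - W)]
  have k5 : h * (z * d) ≤ (b₁ * h + b₂) * (h + l * d ^ 2) := by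
    have c1 : h * (z * d) ≤ h * ((2 * S * G + 2 * f * d) * d) := by gcongr
    have c2 : 2 * f * (h * d ^ 2) ≤ b₁ * l * (h * d ^ 2) := by gcongr
    have c3 : 0 ≤ b₂ * h := by positivity
    have c4 : h * ((2 * S * G + 2 * f * d) * d) = 2 * S * G * d * h + 2 * f * (h * d ^ 2) := by ring
    have c5 : (b₁ * h + b₂) * (h + l * d ^ 2)
      = (b₁ * h ^ 2 + b₂ * (l * d ^ 2)) + b₁ * l * (h * d ^ 2) + b₂ * h := by ring
    linarith
  have k6 : 0 < h + l * d ^ 2 := by positivity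
  have k7 : h * (h + l * d ^ 2) ≤ g * (b₁ * h + b₂) * (h + l * d ^ 2) := by
    calc h * (h + l * d ^ 2) ≤ h * (g * (z * d)) := by gcongr; linarith
      _ = g * (h * (z * d)) := by ring
      _ ≤ g * ((b₁ * h + b₂) * (h + l * d ^ 2)) := by gcongr
      _ = _ := by ring
  exact le_of_mul_le_mul_right k7 k6
end aux

lemma lyap_tr {n : ℕ} (G Y D S : Matrix (Fin n) (Fin n) ℝ) (h1 : G * Y + Y * Gᵀ + 1 = 0)
    (h2 : Gᵀ * D + D * G + S = 0) : D.trace = (S * Y).trace := by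
  have e1 : (D * (G * Y + Y * Gᵀ + 1)).trace = 0 := by rw [h1]; simp
  have e2 : ((Gᵀ * D + D * G + S) * Y).trace = 0 := by rw [h2]; simp
  simp only [Matrix.mul_add, Matrix.add_mul, trace_add, Matrix.mul_one] at e1 e2
  have e3 : (D * (Y * Gᵀ)).trace = (Gᵀ * D * Y).trace := by
    rw [← Matrix.mul_assoc, trace_mul_comm, Matrix.mul_assoc]
  have e4 : (D * (G * Y)).trace = (D * G * Y).trace := by rw [Matrix.mul_assoc]
  linarith

open scoped MatrixOrder ComplexOrder Matrix.Norms.L2Operator in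
lemma psd_factor {n : ℕ} (Y : Matrix (Fin n) (Fin n) ℝ) (hY : Y.PosSemidef) :
    ∃ B : Matrix (Fin n) (Fin n) ℝ, Y = Bᵀ * B := by
  obtain ⟨B, hB⟩ := (CStarAlgebra.nonneg_iff_eq_star_mul_self (a := Y)).1 hY.nonneg
  exact ⟨B, by simpa [Matrix.star_eq_conjTranspose] using hB⟩

set_option maxHeartbeats 1000000 in
theorem main_aux (n m : ℕ) (hn : 1 ≤ n) (hm : 1 ≤ m)
    (A : Matrix (Fin n) (Fin n) ℝ) (F : Matrix (Fin n) (Fin m) ℝ) (hF : F ≠ 0)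
    (Q : Matrix (Fin n) (Fin n) ℝ) (R : Matrix (Fin m) (Fin m) ℝ)
    (hR : R.PosDef)
    (Pstar : Matrix (Fin n) (Fin n) ℝ) (hPstar : Pstar.PosDef)
    (hRiccati : Aᵀ * Pstar + Pstar * A - Pstar * F * R⁻¹ * Fᵀ * Pstar + Q = 0)
    (Kstar : Matrix (Fin m) (Fin n) ℝ) (hKstar : Kstar = R⁻¹ * Fᵀ * Pstar)
    (Ystar : Matrix (Fin n) (Fin n) ℝ) (hYstar : Ystar.PosDef)
    (hYstarEq : (A - F * Kstar) * Ystar + Ystar * (A - F * Kstar)ᵀ + 1 = 0)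
    (K : Matrix (Fin m) (Fin n) ℝ)
    (PK YK : Matrix (Fin n) (Fin n) ℝ) (hPK : PK.PosDef) (hYK : YK.PosDef)
    (hLyapP : (A - F * K)ᵀ * PK + PK * (A - F * K) + Q + Kᵀ * R * K = 0)
    (hLyapY : (A - F * K) * YK + YK * (A - F * K)ᵀ + 1 = 0)
    (b₁ b₂ : ℝ)
    (hb₁ : b₁ = specNorm F *
        Real.sqrt (2 * (eigMin Ystar hYstar.isHermitian + eigMax Ystar hYstar.isHermitian)) /
        (eigMin R hR.isHermitian * Real.sqrt (eigMin Ystar hYstar.isHermitian)))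
    (hb₂ : b₂ = frobNorm (A - F * Kstar) ^ 2 *
        Real.sqrt (eigMin Ystar hYstar.isHermitian) *
        Real.sqrt (eigMin Ystar hYstar.isHermitian + eigMax Ystar hYstar.isHermitian) /
        (Real.sqrt 2 * specNorm F)) :
    Pstar.trace ≤ PK.trace ∧
    (PK.trace - Pstar.trace) / (b₁ * (PK.trace - Pstar.trace) + b₂) ≤
      frobNorm ((2 : ℝ) • ((R * K - Fᵀ * PK) * YK)) := by
  have Rt : Rᵀ = R := by simpa using hR.isHermitian.eq
  have Pt : Pstarᵀ = Pstar := by simpa using hPstar.isHermitian.eq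
  have PKt : PKᵀ = PK := by simpa using hPK.isHermitian.eq
  have YKt : YKᵀ = YK := by simpa using hYK.isHermitian.eq
  have Yst : Ystarᵀ = Ystar := by simpa using hYstar.isHermitian.eq
  have Ru : IsUnit R.det := (Matrix.isUnit_iff_isUnit_det _).1 hR.isUnit
  have YKu : IsUnit YK.det := (Matrix.isUnit_iff_isUnit_det _).1 hYK.isUnit
  have Ysu : IsUnit Ystar.det := (Matrix.isUnit_iff_isUnit_det _).1 hYstar.isUnit
  have hW : R * Kstar = Fᵀ * Pstar := by
    rw [hKstar, Matrix.mul_assoc, Matrix.mul_nonsing_inv_cancel_left _ _ Ru]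
  have hW' : Kstarᵀ * R = Pstar * F := by
    have := congrArg Matrix.transpose hW
    simpa [Matrix.transpose_mul, Rt, Pt] using this
  have hRic : Kstarᵀ * R * Kstar = Pstar * F * R⁻¹ * Fᵀ * Pstar := by
    rw [hW', hKstar]; simp only [Matrix.mul_assoc]
  -- difference Lyapunov equations
  obtain ⟨Δ, hΔ⟩ : ∃ Δ, Δ = K - Kstar := ⟨_, rfl⟩
  obtain ⟨D, hD⟩ : ∃ D, D = PK - Pstar := ⟨_, rfl⟩
  obtain ⟨E, hE⟩ : ∃ E, E = R * K - Fᵀ * PK := ⟨_, rfl⟩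
  have Dt : Dᵀ = D := by rw [hD, transpose_sub, PKt, Pt]
  have L1 : (A - F * K)ᵀ * D + D * (A - F * K) + Δᵀ * R * Δ = 0 := by
    have : (A - F * K)ᵀ * D + D * (A - F * K) + Δᵀ * R * Δ
      = ((A - F * K)ᵀ * PK + PK * (A - F * K) + Q + Kᵀ * R * K)
        - (Aᵀ * Pstar + Pstar * A - Kstarᵀ * R * Kstar + Q)
        + Kᵀ * (Fᵀ * Pstar - R * Kstar) + (Pstar * F - Kstarᵀ * R) * K := by
      rw [hD, hΔ]
      simp only [transpose_sub, transpose_mul, Matrix.mul_sub, Matrix.sub_mul, Matrix.mul_assoc]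
      abel
    rw [this, hLyapP, hRic, hRiccati, hW, hW']
    simp
  have hED : Fᵀ * D = R * Δ - E := by
    rw [hD, hΔ, hE, Matrix.mul_sub, Matrix.mul_sub, hW]; abel
  have hED' : D * F = Δᵀ * R - Eᵀ := by
    have := congrArg Matrix.transpose hED
    simpa [Matrix.transpose_mul, Rt, Dt] using this
  have L2 : (A - F * Kstar)ᵀ * D + D * (A - F * Kstar) + (Δᵀ * E + Eᵀ * Δ - Δᵀ * R * Δ) = 0 := by
    have : (A - F * Kstar)ᵀ * D + D * (A - F * Kstar) + (Δᵀ * E + Eᵀ * Δ - Δᵀ * R * Δ)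
      = ((A - F * K)ᵀ * D + D * (A - F * K) + Δᵀ * R * Δ)
       + Δᵀ * (Fᵀ * D - (R * Δ - E)) + (D * F - (Δᵀ * R - Eᵀ)) * Δ := by
      have hK : K = Δ + Kstar := by rw [hΔ]; abel
      rw [hK]
      simp only [transpose_sub, transpose_mul, transpose_add, Matrix.mul_sub, Matrix.sub_mul,
        Matrix.mul_add, Matrix.add_mul, Matrix.mul_assoc]
      abel
    rw [this, L1, hED, hED']
    simp
  have t1 := lyap_tr _ _ _ _ hLyapY L1
  have t2 := lyap_tr _ _ _ _ hYstarEq L2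
  have hDtr : D.trace = PK.trace - Pstar.trace := by rw [hD, trace_sub]
  -- factor Ystar
  obtain ⟨B, hB⟩ : ∃ B : Matrix (Fin n) (Fin n) ℝ, Ystar = Bᵀ * B := psd_factor _ hYstar.posSemidef
  have hlp := eigMin_pos R hR hm
  have hyp := eigMin_pos Ystar hYstar hn
  have hyY : eigMin Ystar hYstar.isHermitian ≤ eigMax Ystar hYstar.isHermitian :=
    (eigMin_le _ _ ⟨0, hn⟩).trans (le_eigMax _ _ ⟨0, hn⟩)
  have hD0 : 0 ≤ D.trace := by
    rw [t1]
    obtain ⟨C, hC⟩ : ∃ C : Matrix (Fin n) (Fin n) ℝ, YK = Cᵀ * C := psd_factor _ hYK.posSemidef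
    have h4 := tr_ge R hR.isHermitian (Δ * Cᵀ)
    have h5 : ((Δ * Cᵀ)ᵀ * R * (Δ * Cᵀ)).trace = (Δᵀ * R * Δ * YK).trace := by
      rw [hC, transpose_mul, transpose_transpose]
      rw [show C * Δᵀ * R * (Δ * Cᵀ) = C * (Δᵀ * R * Δ * Cᵀ) by simp only [Matrix.mul_assoc],
        trace_mul_comm]
      simp only [Matrix.mul_assoc]
    have h6 : 0 ≤ eigMin R hR.isHermitian * frobNorm (Δ * Cᵀ) ^ 2 := by positivity
    linarith
  refine ⟨by linarith, ?_⟩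
  rw [← hDtr, ← hE]
  -- inverse of YK
  obtain ⟨X, hX⟩ : ∃ X, X = YK⁻¹ := ⟨_, rfl⟩
  have Xt : Xᵀ = X := by rw [hX, transpose_nonsing_inv, YKt]
  have YX : YK * X = 1 := by rw [hX, mul_nonsing_inv _ YKu]
  have XY : X * YK = 1 := by rw [hX, nonsing_inv_mul _ YKu]
  obtain ⟨V, hV⟩ : ∃ V, V = Ystar⁻¹ := ⟨_, rfl⟩
  have Vt : Vᵀ = V := by rw [hV, transpose_nonsing_inv, Yst]
  have YV : Ystar * V = 1 := by rw [hV, mul_nonsing_inv _ Ysu]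
  have VY : V * Ystar = 1 := by rw [hV, nonsing_inv_mul _ Ysu]
  have f1 : (Δ * Bᵀ)ᵀ = B * Δᵀ := by rw [transpose_mul, transpose_transpose]
  have h5 := tr_ge R hR.isHermitian (Δ * Bᵀ)
  have h5' : ((Δ * Bᵀ)ᵀ * R * (Δ * Bᵀ)).trace = (Δᵀ * R * Δ * Ystar).trace := by
    rw [hB, f1]
    rw [show B * Δᵀ * R * (Δ * Bᵀ) = B * (Δᵀ * R * Δ * Bᵀ) by simp only [Matrix.mul_assoc],
      trace_mul_comm]
    simp only [Matrix.mul_assoc]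
  have c1 : (Δᵀ * E * Ystar).trace = (E * Ystar * Δᵀ).trace := by
    rw [Matrix.mul_assoc, trace_mul_comm]
  have c2 : (Eᵀ * Δ * Ystar).trace = (E * Ystar * Δᵀ).trace := by
    rw [← trace_transpose]
    simp only [transpose_mul, transpose_transpose, Yst]
    rw [← Matrix.mul_assoc, trace_mul_comm, Matrix.mul_assoc]
  have t2' : D.trace + (Δᵀ * R * Δ * Ystar).trace = 2 * (E * Ystar * Δᵀ).trace := by
    rw [t2, Matrix.sub_mul, Matrix.add_mul, trace_sub, trace_add, c1, c2]; ring
  have c3 : 2 * (E * Ystar * Δᵀ).trace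
      ≤ frobNorm ((2 : ℝ) • (E * YK)) * (frobNorm (B * X) * frobNorm (Δ * Bᵀ)) := by
    have e : E * Ystar * Δᵀ = (E * YK) * ((B * X)ᵀ * (Δ * Bᵀ)ᵀ) := by
      rw [f1, transpose_mul, Xt, hB]
      calc E * (Bᵀ * B) * Δᵀ = E * (YK * X) * (Bᵀ * B) * Δᵀ := by rw [YX, Matrix.mul_one]
        _ = _ := by simp only [Matrix.mul_assoc]
    have e' : 2 * (E * Ystar * Δᵀ).trace
        = (((((2 : ℝ) • (E * YK))ᵀ)ᵀ) * ((B * X)ᵀ * (Δ * Bᵀ)ᵀ)).trace := by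
      rw [e, transpose_transpose, Matrix.smul_mul, trace_smul, smul_eq_mul]
    rw [e']
    refine (frob_cs _ _).trans ?_
    rw [frob_transpose]
    apply mul_le_mul_of_nonneg_left _ (frob_nonneg _)
    refine (frob_mul _ _).trans ?_
    rw [frob_transpose, frob_transpose]
  -- bound on z
  have hz2 : frobNorm (B * X) ^ 2 = X.trace + 2 * (X * F * Δ * Ystar).trace := by
    have e0 : (B * X)ᵀ * (B * X) = X * Ystar * X := by
      rw [transpose_mul, Xt, hB]; simp only [Matrix.mul_assoc]
    rw [frob_sq, e0]
    have g1 : (X * ((A - F * K) * YK + YK * (A - F * K)ᵀ + 1) * X * Ystar).trace = 0 := by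
      rw [hLyapY]; simp
    have g2 : (X * ((A - F * Kstar) * Ystar + Ystar * (A - F * Kstar)ᵀ + 1)).trace = 0 := by
      rw [hYstarEq]; simp
    have g3 : X * ((A - F * K) * YK + YK * (A - F * K)ᵀ + 1) * X * Ystar
        = X * (A - F * K) * (YK * X) * Ystar + (X * YK) * (A - F * K)ᵀ * X * Ystar
          + X * X * Ystar := by
      simp only [Matrix.mul_add, Matrix.add_mul, Matrix.mul_assoc, Matrix.one_mul]
    rw [g3, YX, XY, Matrix.mul_one, Matrix.one_mul, trace_add, trace_add] at g1
    have g4 : ((A - F * K)ᵀ * X * Ystar).trace = (X * (A - F * K) * Ystar).trace := by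
      rw [← trace_transpose]
      simp only [transpose_mul, transpose_transpose, Yst, Xt]
      rw [trace_mul_comm]
    have g5 : (X * X * Ystar).trace = (X * Ystar * X).trace := by
      rw [Matrix.mul_assoc, trace_mul_comm]
    have g6 : (X * (Ystar * (A - F * Kstar)ᵀ)).trace = (X * (A - F * Kstar) * Ystar).trace := by
      rw [← trace_transpose]
      simp only [transpose_mul, transpose_transpose, Yst, Xt]
      rw [trace_mul_comm, Matrix.mul_assoc]
    rw [Matrix.mul_add, Matrix.mul_add, trace_add, trace_add, g6, Matrix.mul_one,
      ← Matrix.mul_assoc] at g2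
    have g7 : X * (A - F * K) * Ystar = X * (A - F * Kstar) * Ystar - X * F * Δ * Ystar := by
      rw [hΔ]
      simp only [Matrix.mul_sub, Matrix.sub_mul, Matrix.mul_assoc]
      abel
    rw [g4, g5, g7, trace_sub] at g1
    linarith
  have hz3 : (X * F * Δ * Ystar).trace ≤ frobNorm (B * X) * (specNorm F * frobNorm (Δ * Bᵀ)) := by
    have e : (X * F * Δ * Ystar).trace = ((B * X)ᵀᵀ * (F * (Δ * Bᵀ))).trace := by
      rw [transpose_transpose, hB, Matrix.mul_assoc B, trace_mul_comm B]
      simp only [Matrix.mul_assoc]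
    rw [e]
    refine (frob_cs _ _).trans ?_
    rw [frob_transpose]
    exact mul_le_mul_of_nonneg_left (spec_mul _ _) (frob_nonneg _)
  have hVtr : 0 ≤ V.trace := by
    have := hYstar.inv.posSemidef.trace_nonneg
    rwa [← hV] at this
  have hz4 : X.trace ≤ frobNorm (B * X) * Real.sqrt V.trace := by
    have e : X = (B * X)ᵀ * (B * V) := by
      rw [transpose_mul, Xt]
      calc X = X * (Ystar * V) := by rw [YV, Matrix.mul_one]
        _ = _ := by rw [hB]; simp only [Matrix.mul_assoc]
    have e2 : frobNorm (B * V) = Real.sqrt V.trace := by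
      rw [← Real.sqrt_sq (frob_nonneg (B * V)), frob_sq, transpose_mul, Vt]
      congr 2
      calc V * Bᵀ * (B * V) = V * ((Bᵀ * B) * V) := by simp only [Matrix.mul_assoc]
        _ = V := by rw [← hB, YV, Matrix.mul_one]
    rw [← e2]
    conv_lhs => rw [e]
    exact frob_cs _ _
  have hz5 : frobNorm (B * X) ≤ Real.sqrt V.trace + 2 * specNorm F * frobNorm (Δ * Bᵀ) := by
    rcases (frob_nonneg (B * X)).eq_or_lt with h | h
    · rw [← h]
      have := frob_nonneg (Δ * Bᵀ)
      have := spec_pos F hF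
      positivity
    · refine le_of_mul_le_mul_left ?_ h
      nlinarith
  have hV1 : frobNorm V ≤ 2 * frobNorm (A - F * Kstar) := by
    have g1 : (V * ((A - F * Kstar) * Ystar + Ystar * (A - F * Kstar)ᵀ + 1) * V).trace = 0 := by
      rw [hYstarEq]; simp
    have g3 : V * ((A - F * Kstar) * Ystar + Ystar * (A - F * Kstar)ᵀ + 1) * V
        = V * (A - F * Kstar) * (Ystar * V) + (V * Ystar) * (A - F * Kstar)ᵀ * V + V * V := by
      simp only [Matrix.mul_add, Matrix.add_mul, Matrix.mul_assoc, Matrix.one_mul]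
    rw [g3, YV, VY, Matrix.mul_one, Matrix.one_mul, trace_add, trace_add] at g1
    have g4 : ((A - F * Kstar)ᵀ * V).trace = (V * (A - F * Kstar)).trace := by
      rw [← trace_transpose]
      simp only [transpose_mul, transpose_transpose, Vt]
    have g5 : frobNorm V ^ 2 = (V * V).trace := by rw [frob_sq, Vt]
    have g6 := frob_cs (-V) (A - F * Kstar)
    have g7 : frobNorm (-V) = frobNorm V := by simp [frobNorm]
    rw [g7, transpose_neg, Vt, Matrix.neg_mul, trace_neg] at g6
    rcases (frob_nonneg V).eq_or_lt with h | h
    · rw [← h]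
      have := frob_nonneg (A - F * Kstar)
      positivity
    · refine le_of_mul_le_mul_left ?_ h
      nlinarith
  have hV2 : V.trace ≤ eigMax Ystar hYstar.isHermitian * frobNorm V ^ 2 := by
    have := tr_le Ystar hYstar.isHermitian V
    rwa [Vt, VY, Matrix.one_mul] at this
  have hV3 : Real.sqrt V.trace
      ≤ 2 * Real.sqrt (eigMax Ystar hYstar.isHermitian) * frobNorm (A - F * Kstar) := by
    have hYp : 0 ≤ eigMax Ystar hYstar.isHermitian := by linarith
    calc Real.sqrt V.trace ≤ Real.sqrt (eigMax Ystar hYstar.isHermitian * frobNorm V ^ 2) :=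
          Real.sqrt_le_sqrt hV2
      _ = Real.sqrt (eigMax Ystar hYstar.isHermitian) * frobNorm V := by
          rw [Real.sqrt_mul hYp, Real.sqrt_sq (frob_nonneg V)]
      _ ≤ Real.sqrt (eigMax Ystar hYstar.isHermitian) * (2 * frobNorm (A - F * Kstar)) := by
          gcongr
      _ = _ := by ring
  exact scalar_core D.trace (frobNorm (Δ * Bᵀ)) (frobNorm (B * X)) (specNorm F)
    (eigMin R hR.isHermitian) (eigMin Ystar hYstar.isHermitian) (eigMax Ystar hYstar.isHermitian)
    (frobNorm (A - F * Kstar)) (frobNorm ((2 : ℝ) • (E * YK)))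
    (D.trace + (Δᵀ * R * Δ * Ystar).trace) b₁ b₂ hD0 (frob_nonneg _)
    (spec_pos F hF) hlp hyp hyY (frob_nonneg _) (frob_nonneg _) (by linarith)
    (by linarith) (by linarith) hb₁ hb₂

/-- the `K`-PL inequality for the LQR cost: for any stabilizing gain `K`
(witnessed by positive definite solutions `P_K, Y_K` of the associated Lyapunov equations),
the suboptimality `h = tr(P_K) − tr(P*)` is nonnegative and the Frobenius norm of the
policy gradient `2(RK − Fᵀ P_K) Y_K` is at least `h / (b₁ h + b₂)`. -/
theorem stmt_6 (n m : ℕ) (hn : 1 ≤ n) (hm : 1 ≤ m)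
    (A : Matrix (Fin n) (Fin n) ℝ) (F : Matrix (Fin n) (Fin m) ℝ) (hF : F ≠ 0)
    (Q : Matrix (Fin n) (Fin n) ℝ) (R : Matrix (Fin m) (Fin m) ℝ)
    (hQ : Q.PosDef) (hR : R.PosDef)
    (Pstar : Matrix (Fin n) (Fin n) ℝ) (hPstar : Pstar.PosDef)
    (hRiccati : Aᵀ * Pstar + Pstar * A - Pstar * F * R⁻¹ * Fᵀ * Pstar + Q = 0)
    (Kstar : Matrix (Fin m) (Fin n) ℝ) (hKstar : Kstar = R⁻¹ * Fᵀ * Pstar)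
    (Ystar : Matrix (Fin n) (Fin n) ℝ) (hYstar : Ystar.PosDef)
    (hYstarEq : (A - F * Kstar) * Ystar + Ystar * (A - F * Kstar)ᵀ + 1 = 0)
    (K : Matrix (Fin m) (Fin n) ℝ)
    (PK YK : Matrix (Fin n) (Fin n) ℝ) (hPK : PK.PosDef) (hYK : YK.PosDef)
    (hLyapP : (A - F * K)ᵀ * PK + PK * (A - F * K) + Q + Kᵀ * R * K = 0)
    (hLyapY : (A - F * K) * YK + YK * (A - F * K)ᵀ + 1 = 0)
    (b₁ b₂ : ℝ)
    (hb₁ : b₁ = specNorm F *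
        Real.sqrt (2 * (eigMin Ystar hYstar.isHermitian + eigMax Ystar hYstar.isHermitian)) /
        (eigMin R hR.isHermitian * Real.sqrt (eigMin Ystar hYstar.isHermitian)))
    (hb₂ : b₂ = frobNorm (A - F * Kstar) ^ 2 *
        Real.sqrt (eigMin Ystar hYstar.isHermitian) *
        Real.sqrt (eigMin Ystar hYstar.isHermitian + eigMax Ystar hYstar.isHermitian) /
        (Real.sqrt 2 * specNorm F)) :
    Pstar.trace ≤ PK.trace ∧
    (PK.trace - Pstar.trace) / (b₁ * (PK.trace - Pstar.trace) + b₂) ≤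
      frobNorm ((2 : ℝ) • ((R * K - Fᵀ * PK) * YK)) := by
  exact main_aux n m hn hm A F hF Q R hR Pstar hPstar hRiccati Kstar hKstar Ystar hYstar hYstarEq
    K PK YK hPK hYK hLyapP hLyapY b₁ b₂ hb₁ hb₂
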